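/- Let C be a monoidal category, F : Cᵒᵖ ⥤ Type u a lax monoidal functor with unit map e_F and multiplication maps μ, and (A, Δ, ε_A) a comonoid object in C. Let B be an object of C equipped with a coaction ρ : B ⟶ A ⊗ B satisfying coassociativity (ρ followed by 𝟙_A ⊗ ρ equals ρ followed by Δ ⊗ 𝟙_B composed with the associator α_{A,A,B}) and counitality (ρ followed by ε_A ⊗ 𝟙_B and the left unitor equals 𝟙_B). Then the map F(A) × F(B) → F(B), (a, x) ↦ a • x := F(ρᵒᵖ)(μ_{A,B}(a, x)), makes F(B) a module over the monoid F(A): (a ∘ b) • x = a • (b • x) and 1 • x = x, where ∘ and 1 are the monoid structure on F(A) induced by Δ and ε_A. -/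

import Mathlib

open CategoryTheory CategoryTheory.MonoidalCategory Opposite

/-- If `F : Cᵒᵖ ⥤ Type u` is a lax monoidal functor, `(A, Δ, εA)` a comonoid object in `C`,
and `ρ : B ⟶ A ⊗ B` a coassociative and counital coaction, then
`a • x := F(ρᵒᵖ)(μ (a, x))` makes `F(B)` a module over the monoid `F(A)` whose
multiplication is induced by `Δ` and whose unit is induced by `εA`. -/
theorem stmt1 {C : Type*} [Category C] [MonoidalCategory C]
    (F : Cᵒᵖ ⥤ Type u) [F.LaxMonoidal]
    (A : C) (Δ : A ⟶ A ⊗ A) (εA : A ⟶ 𝟙_ C)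
    (hcoassoc : Δ ≫ (Δ ▷ A) ≫ (α_ A A A).hom = Δ ≫ (A ◁ Δ))
    (hcounit_left : Δ ≫ (εA ▷ A) ≫ (λ_ A).hom = 𝟙 A)
    (hcounit_right : Δ ≫ (A ◁ εA) ≫ (ρ_ A).hom = 𝟙 A)
    (B : C) (ρ : B ⟶ A ⊗ B)
    (hρ_coassoc : ρ ≫ (A ◁ ρ) = ρ ≫ (Δ ▷ B) ≫ (α_ A A B).hom)
    (hρ_counit : ρ ≫ (εA ▷ B) ≫ (λ_ B).hom = 𝟙 B)
    (mul : F.obj (op A) → F.obj (op A) → F.obj (op A))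
    (hmul : ∀ x y, mul x y = F.map Δ.op (Functor.LaxMonoidal.μ F (op A) (op A) (x, y)))
    (one : F.obj (op A))
    (hone : one = F.map εA.op (Functor.LaxMonoidal.ε F PUnit.unit))
    (smul : F.obj (op A) → F.obj (op B) → F.obj (op B))
    (hsmul : ∀ a x, smul a x = F.map ρ.op (Functor.LaxMonoidal.μ F (op A) (op B) (a, x))) :
    (∀ (a b : F.obj (op A)) (x : F.obj (op B)), smul (mul a b) x = smul a (smul b x)) ∧
    (∀ x : F.obj (op B), smul one x = x) := by
  have hnl : ∀ {X Y : C} (f : Y ⟶ X) (Z : C) (u : F.obj (op X)) (v : F.obj (op Z)),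
      Functor.LaxMonoidal.μ F (op Y) (op Z) (F.map f.op u, v) =
        F.map (f ▷ Z).op (Functor.LaxMonoidal.μ F (op X) (op Z) (u, v)) := fun f Z u v => by
      have h := fun p => ConcreteCategory.congr_hom (Functor.LaxMonoidal.μ_natural_left F f.op (op Z)) p
      exact h (u, v)
  have hnr : ∀ {X Y : C} (Z : C) (f : Y ⟶ X) (v : F.obj (op Z)) (u : F.obj (op X)),
      Functor.LaxMonoidal.μ F (op Z) (op Y) (v, F.map f.op u) =
        F.map (Z ◁ f).op (Functor.LaxMonoidal.μ F (op Z) (op X) (v, u)) := fun Z f v u => by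
      have h := fun p => ConcreteCategory.congr_hom (Functor.LaxMonoidal.μ_natural_right F (op Z) f.op) p
      exact h (v, u)
  have hass : ∀ (a b : F.obj (op A)) (x : F.obj (op B)),
      F.map (α_ A A B).inv.op (Functor.LaxMonoidal.μ F (op (A ⊗ A)) (op B)
        (Functor.LaxMonoidal.μ F (op A) (op A) (a, b), x)) =
      Functor.LaxMonoidal.μ F (op A) (op (A ⊗ B))
        (a, Functor.LaxMonoidal.μ F (op A) (op B) (b, x)) := fun a b x => by
      have h := fun p => ConcreteCategory.congr_hom (Functor.LaxMonoidal.associativity F (op A) (op A) (op B)) p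
      exact h ((a, b), x)
  have hun : ∀ x : F.obj (op B),
      Functor.LaxMonoidal.μ F (op (𝟙_ C)) (op B) (Functor.LaxMonoidal.ε F PUnit.unit, x) =
        F.map (λ_ B).hom.op x := fun x =>
    ConcreteCategory.congr_hom (Functor.LaxMonoidal.left_unitality_inv F (op B)) x
  have hcomp : ∀ {X Y Z : C} (f : X ⟶ Y) (g : Y ⟶ Z) (z : F.obj (op Z)),
      F.map f.op (F.map g.op z) = F.map (f ≫ g).op z := fun f g z =>
    (ConcreteCategory.congr_hom (F.map_comp g.op f.op) z).symm
  refine ⟨fun a b x => ?_, fun x => ?_⟩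
  · rw [hsmul, hmul, hsmul, hsmul, hnl, hnr, ← hass, hcomp, hcomp, hcomp,
      hρ_coassoc]
    simp only [Category.assoc, Iso.hom_inv_id, Category.comp_id]
  · rw [hsmul, hone, hnl, hun, hcomp, hcomp, Category.assoc, hρ_counit]
    exact ConcreteCategory.congr_hom (F.map_id (op B)) x
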